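/- Let β ∈ Φ⁺ be a positive root with a positive expression β = s_{i_r}⋯s_{i_1}(α_j), and set δ_k = s_{i_r}⋯s_{i_{k+1}}(α_{i_k}) for 1 ≤ k ≤ r. Then the following three sets of rank two subsystems coincide: (1) the set of rank two subsystems R that cut β^⊥; (2) the set of subsystems of the form Φ ∩ span_ℝ(β, γ) where γ ∈ inv_Φ(t_β) and γ ≠ β; (3) the set of subsystems of the form Φ ∩ span_ℝ(β, δ_k) for 1 ≤ k ≤ r. -/

import Mathlib

/-!
Setup: a symmetrizable crystallographic Cartan matrix `A` with symmetrizers `d`,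
the vector space `V = Fin n → ℝ` with standard basis `α i = Pi.single i 1`,
the bilinear form `(α i, α j) = d i * A i j`, the simple reflections
`s i (x) = x - (dᵢ⁻¹ αᵢ, x) αᵢ`, the group `W` generated by them (elements of
which are represented as products of lists of simple reflections), and the
set of real roots `Φ = { w (α i) }`.
-/

open Finset

noncomputable section

/-- The simple root `α i`, i.e. the `i`-th standard basis vector of `ℝⁿ`. -/
def sroot (n : ℕ) (i : Fin n) : Fin n → ℝ := Pi.single i 1

/-- The symmetric bilinear form with `(α i, α j) = d i * A i j`. -/
def formL (n : ℕ) (d : Fin n → ℤ) (A : Fin n → Fin n → ℤ) :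
    (Fin n → ℝ) →ₗ[ℝ] (Fin n → ℝ) →ₗ[ℝ] ℝ :=
  ∑ i : Fin n, ∑ j : Fin n,
    ((d i * A i j : ℤ) : ℝ) •
      LinearMap.smulRight (LinearMap.proj i : (Fin n → ℝ) →ₗ[ℝ] ℝ)
        (LinearMap.proj j : (Fin n → ℝ) →ₗ[ℝ] ℝ)

/-- The simple reflection `s i`, given by `s i x = x - (dᵢ⁻¹ • αᵢ, x) • αᵢ`. -/
def simpleRefl (n : ℕ) (d : Fin n → ℤ) (A : Fin n → Fin n → ℤ) (i : Fin n) :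
    Module.End ℝ (Fin n → ℝ) :=
  LinearMap.id - ((d i : ℝ)⁻¹) • (formL n d A (sroot n i)).smulRight (sroot n i)

/-- The element `s i_r * ⋯ * s i_1` of `W` corresponding to the list `l = [i_1, …, i_r]`
(the reflection `s i_1` is applied first). -/
def wprod (n : ℕ) (d : Fin n → ℤ) (A : Fin n → Fin n → ℤ) (l : List (Fin n)) :
    Module.End ℝ (Fin n → ℝ) :=
  ((l.map (simpleRefl n d A)).reverse).prod

/-- `β` is a real root: `β = w (α i)` for some `w ∈ W` and some `i`. -/
def IsRoot (n : ℕ) (d : Fin n → ℤ) (A : Fin n → Fin n → ℤ) (β : Fin n → ℝ) : Prop :=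
  ∃ (l : List (Fin n)) (i : Fin n), β = wprod n d A l (sroot n i)

/-- `β` is a positive root: a real root all of whose coordinates are `≥ 0`. -/
def IsPosRoot (n : ℕ) (d : Fin n → ℤ) (A : Fin n → Fin n → ℤ) (β : Fin n → ℝ) : Prop :=
  IsRoot n d A β ∧ ∀ k, 0 ≤ β k

/-- `β` is a negative root: a real root all of whose coordinates are `≤ 0`. -/
def IsNegRoot (n : ℕ) (d : Fin n → ℤ) (A : Fin n → Fin n → ℤ) (β : Fin n → ℝ) : Prop :=
  IsRoot n d A β ∧ ∀ k, β k ≤ 0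

/-- The reflection `t_β` along a root `β`: `t_β x = x - (β^∨, x) • β` where
`β^∨ = d_β⁻¹ • β` and `d_β = (β, β)/2`. -/
def reflAlong (n : ℕ) (d : Fin n → ℤ) (A : Fin n → Fin n → ℤ) (β : Fin n → ℝ) :
    Module.End ℝ (Fin n → ℝ) :=
  LinearMap.id - (2 / formL n d A β β) • (formL n d A β).smulRight β

/-- `s i_r ⋯ s i_1 (α j)` (encoded by the list `l = [i_1, …, i_r]` and the index `j`)
is a positive expression: each partial application moves up in the root poset, i.e.
`s i_k ⋯ s i_1 (α j) - s i_{k-1} ⋯ s i_1 (α j) ∈ ℝ_{>0} • α i_k` for all `k`. -/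
def IsPosExpr (n : ℕ) (d : Fin n → ℤ) (A : Fin n → Fin n → ℤ) (j : Fin n)
    (l : List (Fin n)) : Prop :=
  ∀ k : Fin l.length, ∃ c : ℝ, 0 < c ∧
    wprod n d A (l.take (k.1 + 1)) (sroot n j) - wprod n d A (l.take k.1) (sroot n j)
      = c • sroot n (l.get k)

/-- The length `ℓ(w)`: the smallest `r` such that `w` is a product of `r` simple
reflections. -/
def len (n : ℕ) (d : Fin n → ℤ) (A : Fin n → Fin n → ℤ)
    (w : Module.End ℝ (Fin n → ℝ)) : ℕ :=
  sInf {r | ∃ l : List (Fin n), l.length = r ∧ wprod n d A l = w}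

/-- The inversion set `inv_Φ(t_β)` of the reflection along a positive root `β`:
positive roots sent to negative roots by `t_β`. -/
def invSet (n : ℕ) (d : Fin n → ℤ) (A : Fin n → Fin n → ℤ) (β : Fin n → ℝ) :
    Set (Fin n → ℝ) :=
  {γ | IsPosRoot n d A γ ∧ IsNegRoot n d A (reflAlong n d A β γ)}

/-- `R` is a rank two subsystem: `R = Φ ∩ L` for a two-dimensional subspace `L`
which is spanned by `R`. -/
def IsRankTwo (n : ℕ) (d : Fin n → ℤ) (A : Fin n → Fin n → ℤ)
    (R : Set (Fin n → ℝ)) : Prop :=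
  ∃ L : Submodule ℝ (Fin n → ℝ), Module.finrank ℝ L = 2 ∧
    R = {γ | IsRoot n d A γ} ∩ (L : Set (Fin n → ℝ)) ∧ Submodule.span ℝ R = L

/-- `β` is a fundamental root of `R`: it is a positive root of `R` and there is a
second positive root `β'` of `R` such that every positive root of `R` is a
nonnegative combination of `β` and `β'`. -/
def IsFundamentalIn (n : ℕ) (d : Fin n → ℤ) (A : Fin n → Fin n → ℤ)
    (R : Set (Fin n → ℝ)) (β : Fin n → ℝ) : Prop :=
  β ∈ R ∧ IsPosRoot n d A β ∧
    ∃ β' ∈ R, IsPosRoot n d A β' ∧ β' ≠ β ∧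
      ∀ γ ∈ R, IsPosRoot n d A γ →
        ∃ c c' : ℝ, 0 ≤ c ∧ 0 ≤ c' ∧ γ = c • β + c' • β'

/-- The rank two subsystem `R` cuts `β^⊥`: `β ∈ R` but `β` is not a fundamental
root of `R`. -/
def CutsPerp (n : ℕ) (d : Fin n → ℤ) (A : Fin n → Fin n → ℤ)
    (R : Set (Fin n → ℝ)) (β : Fin n → ℝ) : Prop :=
  IsRankTwo n d A R ∧ β ∈ R ∧ ¬ IsFundamentalIn n d A R β

/-- The standing hypotheses. -/
structure CartanH (n : ℕ) (d : Fin n → ℤ) (A : Fin n → Fin n → ℤ) : Prop where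
  hd : ∀ i, 0 < d i
  hdiag : ∀ i, A i i = 2
  hoff : ∀ i j, i ≠ j → A i j ≤ 0
  hsym : ∀ i j, d i * A i j = d j * A j i

section aux

variable {n : ℕ} {d : Fin n → ℤ} {A : Fin n → Fin n → ℤ}

theorem formL_apply (x y : Fin n → ℝ) :
    formL n d A x y = ∑ i, ∑ j, ((d i : ℝ) * A i j) * (x i * y j) := by
  simp [formL, LinearMap.sum_apply, mul_assoc]

/-- the pairing with the simple coroot -/
def cp (A : Fin n → Fin n → ℤ) (i : Fin n) (x : Fin n → ℝ) : ℝ := ∑ m, (A i m : ℝ) * x m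

theorem cp_add (i : Fin n) (x y : Fin n → ℝ) : cp A i (x + y) = cp A i x + cp A i y := by
  simp [cp, mul_add, Finset.sum_add_distrib]

theorem cp_smul (i : Fin n) (c : ℝ) (x : Fin n → ℝ) : cp A i (c • x) = c * cp A i x := by
  simp only [cp, Finset.mul_sum, Pi.smul_apply, smul_eq_mul]
  exact Finset.sum_congr rfl fun _ _ => by ring

theorem cp_sub (i : Fin n) (x y : Fin n → ℝ) : cp A i (x - y) = cp A i x - cp A i y := by
  simp [cp, mul_sub, Finset.sum_sub_distrib]

theorem cp_sroot (i k : Fin n) : cp A i (sroot n k) = A i k := by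
  simp [cp, sroot, Pi.single_apply]

theorem form_sroot (i : Fin n) (x : Fin n → ℝ) :
    formL n d A (sroot n i) x = d i * cp A i x := by
  rw [formL_apply, Finset.sum_eq_single i]
  · simp [sroot, cp, Finset.mul_sum, mul_assoc]
  · intro b _ hb
    simp [sroot, hb]
  · simp

theorem form_symm (H : CartanH n d A) (x y : Fin n → ℝ) :
    formL n d A x y = formL n d A y x := by
  rw [formL_apply, formL_apply, Finset.sum_comm]
  refine Finset.sum_congr rfl fun i _ => Finset.sum_congr rfl fun j _ => ?_
  have : (d i : ℝ) * A i j = d j * A j i := by exact_mod_cast H.hsym i j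
  rw [this]; ring

theorem s_apply (H : CartanH n d A) (i : Fin n) (x : Fin n → ℝ) :
    simpleRefl n d A i x = x - cp A i x • sroot n i := by
  have h : (d i : ℝ) ≠ 0 := by exact_mod_cast (H.hd i).ne'
  simp [simpleRefl, form_sroot, smul_smul, h]

theorem s_sroot (H : CartanH n d A) (i : Fin n) :
    simpleRefl n d A i (sroot n i) = - sroot n i := by
  rw [s_apply H, cp_sroot, H.hdiag]; ext k; simp; ring

theorem s_s (H : CartanH n d A) (i : Fin n) (x : Fin n → ℝ) :
    simpleRefl n d A i (simpleRefl n d A i x) = x := by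
  rw [s_apply H i x, map_sub, map_smul, s_sroot H, s_apply H]
  ext k; simp

theorem form_s (H : CartanH n d A) (i : Fin n) (x y : Fin n → ℝ) :
    formL n d A (simpleRefl n d A i x) (simpleRefl n d A i y) = formL n d A x y := by
  rw [s_apply H, s_apply H]
  simp only [map_sub, map_smul, LinearMap.sub_apply, LinearMap.smul_apply, form_sroot,
    smul_eq_mul, form_symm H x (sroot n i), cp_sroot, H.hdiag]
  push_cast; ring

theorem s_coord (H : CartanH n d A) {i k : Fin n} (h : k ≠ i) (x : Fin n → ℝ) :
    simpleRefl n d A i x k = x k := by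
  rw [s_apply H]; simp [sroot, h]

theorem wprod_nil : wprod n d A [] = 1 := by simp [wprod]

theorem wprod_cons (i : Fin n) (l : List (Fin n)) :
    wprod n d A (i :: l) = wprod n d A l * simpleRefl n d A i := by simp [wprod]

theorem wprod_append (l l' : List (Fin n)) :
    wprod n d A (l ++ l') = wprod n d A l' * wprod n d A l := by simp [wprod]

theorem wprod_concat (i : Fin n) (l : List (Fin n)) (x : Fin n → ℝ) :
    wprod n d A (l ++ [i]) x = simpleRefl n d A i (wprod n d A l x) := by
  simp [wprod]

theorem s_mul (H : CartanH n d A) (i : Fin n) :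
    simpleRefl n d A i * simpleRefl n d A i = 1 := by
  ext1 x; ext1; simp [s_s H]

theorem wprod_cc (H : CartanH n d A) (i : Fin n) (l : List (Fin n)) :
    wprod n d A (i :: i :: l) = wprod n d A l := by
  rw [wprod_cons, wprod_cons, mul_assoc, s_mul H, mul_one]

theorem wprod_rev (H : CartanH n d A) (l : List (Fin n)) (x : Fin n → ℝ) :
    wprod n d A l.reverse (wprod n d A l x) = x := by
  induction l generalizing x with
  | nil => simp [wprod_nil]
  | cons i l ih =>
    rw [List.reverse_cons, wprod_concat, wprod_cons, Module.End.mul_apply, ih, s_s H]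

theorem wprod_rev' (H : CartanH n d A) (l : List (Fin n)) (x : Fin n → ℝ) :
    wprod n d A l (wprod n d A l.reverse x) = x := by
  simpa using wprod_rev H l.reverse x

theorem form_wprod (H : CartanH n d A) (l : List (Fin n)) (x y : Fin n → ℝ) :
    formL n d A (wprod n d A l x) (wprod n d A l y) = formL n d A x y := by
  induction l generalizing x y with
  | nil => simp [wprod_nil]
  | cons i l ih => simp only [wprod_cons, Module.End.mul_apply, ih, form_s H]

theorem root_sroot (i : Fin n) : IsRoot n d A (sroot n i) := ⟨[], i, by simp [wprod_nil]⟩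

theorem root_s {β : Fin n → ℝ} (h : IsRoot n d A β) (i : Fin n) :
    IsRoot n d A (simpleRefl n d A i β) := by
  obtain ⟨l, j, rfl⟩ := h
  exact ⟨l ++ [i], j, (wprod_concat i l _).symm⟩

theorem root_w {β : Fin n → ℝ} (h : IsRoot n d A β) (l : List (Fin n)) :
    IsRoot n d A (wprod n d A l β) := by
  obtain ⟨l', j, rfl⟩ := h
  exact ⟨l' ++ l, j, by simp [wprod_append]⟩

theorem root_neg (H : CartanH n d A) {β : Fin n → ℝ} (h : IsRoot n d A β) :
    IsRoot n d A (-β) := by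
  obtain ⟨l, j, rfl⟩ := h
  exact ⟨j :: l, j, by simp [wprod_cons, s_sroot H]⟩

theorem root_form (H : CartanH n d A) {β : Fin n → ℝ} (h : IsRoot n d A β) :
    ∃ i, formL n d A β β = 2 * d i := by
  obtain ⟨l, j, rfl⟩ := h
  refine ⟨j, ?_⟩
  rw [form_wprod H, form_sroot, cp_sroot, H.hdiag]; push_cast; ring

theorem root_form_pos (H : CartanH n d A) {β : Fin n → ℝ} (h : IsRoot n d A β) :
    0 < formL n d A β β := by
  obtain ⟨i, hi⟩ := root_form H h
  rw [hi]
  have : (0 : ℝ) < d i := by exact_mod_cast H.hd i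
  linarith

theorem root_ne (H : CartanH n d A) {β : Fin n → ℝ} (h : IsRoot n d A β) : β ≠ 0 := by
  rintro rfl
  simpa using root_form_pos H h

theorem int_w (H : CartanH n d A) (l : List (Fin n)) (z : Fin n → ℤ) :
    ∃ z' : Fin n → ℤ, wprod n d A l (fun k => (z k : ℝ)) = fun k => (z' k : ℝ) := by
  induction l generalizing z with
  | nil => exact ⟨z, by simp [wprod_nil]⟩
  | cons i l ih =>
    rw [wprod_cons]
    have : simpleRefl n d A i (fun k => (z k : ℝ)) =
        fun k => ((z k - (∑ m, A i m * z m) * (Pi.single i 1 : Fin n → ℤ) k : ℤ) : ℝ) := by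
      rw [s_apply H]; ext k
      by_cases hk : k = i
      · subst hk; simp [cp, sroot]
      · simp [sroot, hk]
    rw [Module.End.mul_apply, this]
    exact ih _

theorem sroot_int (i : Fin n) : sroot n i = fun k => (((Pi.single i 1 : Fin n → ℤ) k : ℤ) : ℝ) := by
  ext k
  by_cases hk : k = i
  · subst hk; simp [sroot]
  · simp [sroot, hk]

theorem root_int (H : CartanH n d A) {β : Fin n → ℝ} (h : IsRoot n d A β) :
    ∃ z : Fin n → ℤ, β = fun k => (z k : ℝ) := by
  obtain ⟨l, j, rfl⟩ := h
  rw [sroot_int]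
  exact int_w H l _

/-- reducedness -/
theorem root_smul (H : CartanH n d A) {β : Fin n → ℝ} (h : IsRoot n d A β) {c : ℝ}
    (hc : IsRoot n d A (c • β)) : c = 1 ∨ c = -1 := by
  obtain ⟨l, j, rfl⟩ := h
  have h1 : IsRoot n d A (c • sroot n j) := by
    have := root_w hc l.reverse
    rwa [map_smul, wprod_rev H] at this
  obtain ⟨z, hz⟩ := root_int H h1
  have hcz : c = z j := by simpa [sroot] using congrFun hz j
  obtain ⟨l', i, h2⟩ := h1
  have h3 : c • wprod n d A l'.reverse (sroot n j) = sroot n i := by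
    rw [← map_smul, h2, wprod_rev H]
  obtain ⟨y, hy⟩ := root_int H (root_w (root_sroot j) l'.reverse)
  rw [hy] at h3
  have h4 : c * y i = 1 := by simpa [sroot] using congrFun h3 i
  rw [hcz] at h4 ⊢
  have h5 : z j * y i = 1 := by exact_mod_cast h4
  rcases Int.eq_one_or_neg_one_of_mul_eq_one h5 with h | h <;> simp [h]

theorem refl_apply (β x : Fin n → ℝ) :
    reflAlong n d A β x = x - (2 / formL n d A β β * formL n d A β x) • β := by
  simp [reflAlong, smul_smul]

theorem refl_s (H : CartanH n d A) (i : Fin n) (β x : Fin n → ℝ) :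
    reflAlong n d A (simpleRefl n d A i β) (simpleRefl n d A i x)
      = simpleRefl n d A i (reflAlong n d A β x) := by
  rw [refl_apply, refl_apply, form_s H, form_s H, map_sub, map_smul]

theorem refl_w (H : CartanH n d A) (l : List (Fin n)) (β x : Fin n → ℝ) :
    reflAlong n d A (wprod n d A l β) (wprod n d A l x)
      = wprod n d A l (reflAlong n d A β x) := by
  rw [refl_apply, refl_apply, form_wprod H, form_wprod H, map_sub, map_smul]

theorem refl_sroot (H : CartanH n d A) (i : Fin n) (x : Fin n → ℝ) :
    reflAlong n d A (sroot n i) x = simpleRefl n d A i x := by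
  have h : (d i : ℝ) ≠ 0 := by exact_mod_cast (H.hd i).ne'
  rw [refl_apply, form_sroot, form_sroot, cp_sroot, H.hdiag, s_apply H]
  congr 2
  push_cast
  field_simp

theorem root_refl (H : CartanH n d A) {β γ : Fin n → ℝ} (h : IsRoot n d A β)
    (h' : IsRoot n d A γ) : IsRoot n d A (reflAlong n d A β γ) := by
  obtain ⟨l, j, rfl⟩ := h
  rw [← wprod_rev' H l γ, refl_w H, refl_sroot H]
  exact root_w (root_s (root_w h' _) _) _

theorem refl_self (H : CartanH n d A) {β : Fin n → ℝ} (h : IsRoot n d A β) :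
    reflAlong n d A β β = -β := by
  rw [refl_apply, div_mul_cancel₀ _ (root_form_pos H h).ne']
  ext k; simp; ring

theorem refl_refl (H : CartanH n d A) {β : Fin n → ℝ} (h : IsRoot n d A β) (x : Fin n → ℝ) :
    reflAlong n d A β (reflAlong n d A β x) = x := by
  rw [refl_apply β x, map_sub, map_smul, refl_self H h, refl_apply]
  ext k; simp

/-- the alternating word -/
def altw {n : ℕ} (i b : Fin n) : ℕ → List (Fin n)
  | 0 => []
  | k + 1 => i :: altw b i k

theorem altw_length (i b : Fin n) (k : ℕ) : (altw i b k).length = k := by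
  induction k generalizing i b with
  | zero => rfl
  | succ k ih => simp [altw, ih]

theorem altw_add (i b : Fin n) (k m : ℕ) : ∃ t : List (Fin n), t.length = m ∧
    altw i b (k + m) = altw i b k ++ t := by
  induction k generalizing i b with
  | zero => exact ⟨altw i b m, altw_length _ _ _, by simp [altw]⟩
  | succ k ih =>
    obtain ⟨t, h1, h2⟩ := ih b i
    refine ⟨t, h1, ?_⟩
    rw [Nat.add_right_comm]
    simp [altw, h2]

theorem s_comb (H : CartanH n d A) (i b : Fin n) (z : Fin n → ℝ) (x y : ℝ) :
    simpleRefl n d A i (z + (x • sroot n i + y • sroot n b)) =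
      z + ((-x - A i b * y - cp A i z) • sroot n i + y • sroot n b) := by
  rw [s_apply H, cp_add, cp_add, cp_smul, cp_smul, cp_sroot, cp_sroot, H.hdiag]
  ext k; simp; ring

theorem s_comb' (H : CartanH n d A) (i b : Fin n) (z : Fin n → ℝ) (x y : ℝ) :
    simpleRefl n d A b (z + (x • sroot n i + y • sroot n b)) =
      z + (x • sroot n i + (-y - A b i * x - cp A b z) • sroot n b) := by
  rw [s_apply H, cp_add, cp_add, cp_smul, cp_smul, cp_sroot, cp_sroot, H.hdiag]
  ext k; simp; ring

/-- nonnegative combination predicate -/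
def NN (i b : Fin n) (v : Fin n → ℝ) : Prop :=
  ∃ x y : ℝ, 0 ≤ x ∧ 0 ≤ y ∧ v = x • sroot n i + y • sroot n b

theorem big_pos (H : CartanH n d A) (k : ℕ) : ∀ (i b : Fin n) (x y : ℝ),
    A i b ≤ 0 → A b i ≤ 0 → 4 ≤ A i b * A b i → 0 ≤ x → 0 ≤ y →
    2 * y ≤ -A b i * x → NN i b (wprod n d A (altw b i k) (x • sroot n i + y • sroot n b)) := by
  induction k with
  | zero => intro i b x y _ _ _ hx hy _; exact ⟨x, y, hx, hy, by simp [altw, wprod_nil]⟩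
  | succ k ih =>
    intro i b x y hp hq hpq hx hy hxy
    have e := s_comb' H i b 0 x y
    have e0 : cp A b (0 : Fin n → ℝ) = 0 := by simp [cp]
    rw [zero_add, zero_add, e0] at e
    rw [altw, wprod_cons, Module.End.mul_apply, e]
    have hp' : (A i b : ℝ) ≤ 0 := by exact_mod_cast hp
    have hq' : (A b i : ℝ) ≤ 0 := by exact_mod_cast hq
    have hpq' : (4 : ℝ) ≤ A i b * A b i := by exact_mod_cast hpq
    have h1 : y ≤ (-y - A b i * x - 0) := by linarith
    have h2 : 2 * x ≤ -A i b * (-y - A b i * x - 0) := by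
      have : -A b i * x / 2 ≤ (-y - A b i * x - 0) := by linarith
      have := mul_le_mul_of_nonneg_left this (neg_nonneg.2 hp')
      nlinarith
    obtain ⟨x', y', hx', hy', h⟩ := ih b i _ x hq hp (by linarith [mul_comm (A i b) (A b i)])
      (hy.trans h1) hx h2
    exact ⟨y', x', hy', hx', by rw [add_comm (x • _), h, add_comm]⟩

theorem ends_ext {l l' : List (Fin n)} {i b : Fin n}
    (h : ∀ z, wprod n d A l (z + ((0:ℝ) • sroot n i + (0:ℝ) • sroot n b))
      = wprod n d A l' (z + ((0:ℝ) • sroot n i + (0:ℝ) • sroot n b))) :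
    wprod n d A l = wprod n d A l' := by
  refine LinearMap.ext fun z => ?_
  have := h z
  simpa only [zero_smul, add_zero] using this

theorem fin_case (H : CartanH n d A) {i b : Fin n} (hib : i ≠ b) (hlt : A i b * A b i < 4) :
    ∃ m, 1 ≤ m ∧ wprod n d A (i :: altw b i m) = wprod n d A (altw b i (m - 1)) ∧
      ∀ k < m, NN i b (wprod n d A (altw b i k) (sroot n i)) := by
  have hp := H.hoff i b hib
  have hq := H.hoff b i hib.symm
  have hs := H.hsym i b
  have hdi := H.hd i
  have hdb := H.hd b
  have h0 : A i b = 0 ↔ A b i = 0 := by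
    constructor <;> intro h
    · rw [h, mul_zero] at hs
      rcases mul_eq_zero.1 hs.symm with h | h
      · omega
      · exact h
    · rw [h, mul_zero] at hs
      rcases mul_eq_zero.1 hs with h | h
      · omega
      · exact h
  have key : ∀ k, NN i b (wprod n d A (altw b i k)
      (0 + ((1:ℝ) • sroot n i + (0:ℝ) • sroot n b))) →
      NN i b (wprod n d A (altw b i k) (sroot n i)) := by
    intro k hk; simpa only [zero_add, one_smul, zero_smul, add_zero] using hk
  have c0 : ∀ a, cp A a (0 : Fin n → ℝ) = 0 := fun a => by simp [cp]
  have fin : ∀ (v : Fin n → ℝ) (x y : ℝ), v = 0 + (x • sroot n i + y • sroot n b) → 0 ≤ x → 0 ≤ y →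
      NN i b v := fun v x y h hx hy => ⟨x, y, hx, hy, by rw [h, zero_add]⟩
  have cases : (A i b = 0 ∧ A b i = 0) ∨ (A i b = -1 ∧ A b i = -1) ∨ (A i b = -1 ∧ A b i = -2) ∨
      (A i b = -2 ∧ A b i = -1) ∨ (A i b = -1 ∧ A b i = -3) ∨ (A i b = -3 ∧ A b i = -1) := by
    by_cases hz : A i b = 0
    · exact Or.inl ⟨hz, h0.1 hz⟩
    · have hz' : A b i ≠ 0 := fun h => hz (h0.2 h)
      have h1 : A i b ≤ -1 := by omega
      have h2 : A b i ≤ -1 := by omega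
      have h3 : -4 < A i b := by nlinarith
      have h4 : -4 < A b i := by nlinarith
      generalize A i b = u at *
      generalize A b i = v at *
      interval_cases u <;> interval_cases v <;> simp_all
  rcases cases with ⟨h1, h2⟩ | ⟨h1, h2⟩ | ⟨h1, h2⟩ | ⟨h1, h2⟩ | ⟨h1, h2⟩ | ⟨h1, h2⟩
  · refine ⟨2, by norm_num, ends_ext (i := i) (b := b) fun z => ?_, fun k hk => key k ?_⟩
    · simp only [altw, wprod_cons, wprod_nil, Module.End.mul_apply, Module.End.one_apply,
        s_comb H i b, s_comb' H i b, h1, h2]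
      congr 3 <;> push_cast <;> ring
    · interval_cases k <;> simp only [altw, wprod_cons, wprod_nil, Module.End.mul_apply,
        Module.End.one_apply, s_comb H i b, s_comb' H i b, h1, h2, c0] <;>
        refine fin _ _ _ rfl ?_ ?_ <;> norm_num
  · refine ⟨3, by norm_num, ends_ext (i := i) (b := b) fun z => ?_, fun k hk => key k ?_⟩
    · simp only [altw, wprod_cons, wprod_nil, Module.End.mul_apply, Module.End.one_apply,
        s_comb H i b, s_comb' H i b, h1, h2]
      congr 3 <;> push_cast <;> ring
    · interval_cases k <;> simp only [altw, wprod_cons, wprod_nil, Module.End.mul_apply,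
        Module.End.one_apply, s_comb H i b, s_comb' H i b, h1, h2, c0] <;>
        refine fin _ _ _ rfl ?_ ?_ <;> norm_num
  · refine ⟨4, by norm_num, ends_ext (i := i) (b := b) fun z => ?_, fun k hk => key k ?_⟩
    · simp only [altw, wprod_cons, wprod_nil, Module.End.mul_apply, Module.End.one_apply,
        s_comb H i b, s_comb' H i b, h1, h2]
      congr 3 <;> push_cast <;> ring
    · interval_cases k <;> simp only [altw, wprod_cons, wprod_nil, Module.End.mul_apply,
        Module.End.one_apply, s_comb H i b, s_comb' H i b, h1, h2, c0] <;>
        refine fin _ _ _ rfl ?_ ?_ <;> norm_num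
  · refine ⟨4, by norm_num, ends_ext (i := i) (b := b) fun z => ?_, fun k hk => key k ?_⟩
    · simp only [altw, wprod_cons, wprod_nil, Module.End.mul_apply, Module.End.one_apply,
        s_comb H i b, s_comb' H i b, h1, h2]
      congr 3 <;> push_cast <;> ring
    · interval_cases k <;> simp only [altw, wprod_cons, wprod_nil, Module.End.mul_apply,
        Module.End.one_apply, s_comb H i b, s_comb' H i b, h1, h2, c0] <;>
        refine fin _ _ _ rfl ?_ ?_ <;> norm_num
  · refine ⟨6, by norm_num, ends_ext (i := i) (b := b) fun z => ?_, fun k hk => key k ?_⟩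
    · simp only [altw, wprod_cons, wprod_nil, Module.End.mul_apply, Module.End.one_apply,
        s_comb H i b, s_comb' H i b, h1, h2]
      congr 3 <;> push_cast <;> ring
    · interval_cases k <;> simp only [altw, wprod_cons, wprod_nil, Module.End.mul_apply,
        Module.End.one_apply, s_comb H i b, s_comb' H i b, h1, h2, c0] <;>
        refine fin _ _ _ rfl ?_ ?_ <;> norm_num
  · refine ⟨6, by norm_num, ends_ext (i := i) (b := b) fun z => ?_, fun k hk => key k ?_⟩
    · simp only [altw, wprod_cons, wprod_nil, Module.End.mul_apply, Module.End.one_apply,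
        s_comb H i b, s_comb' H i b, h1, h2]
      congr 3 <;> push_cast <;> ring
    · interval_cases k <;> simp only [altw, wprod_cons, wprod_nil, Module.End.mul_apply,
        Module.End.one_apply, s_comb H i b, s_comb' H i b, h1, h2, c0] <;>
        refine fin _ _ _ rfl ?_ ?_ <;> norm_num

theorem rank2_lemma (H : CartanH n d A) {i b : Fin n} (hib : i ≠ b) (q : List (Fin n))
    (hq : ∀ a ∈ q, a = i ∨ a = b)
    (hred : ∀ q' : List (Fin n), (∀ a ∈ q', a = i ∨ a = b) → wprod n d A q' = wprod n d A q →
      q.length ≤ q'.length)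
    (hi : ∀ q' : List (Fin n), (∀ a ∈ q', a = i ∨ a = b) → wprod n d A q' = wprod n d A (i :: q) →
      q.length ≤ q'.length) :
    NN i b (wprod n d A q (sroot n i)) := by
  -- alternation
  have alt : ∀ q : List (Fin n), (∀ a ∈ q, a = i ∨ a = b) →
      (∀ q' : List (Fin n), (∀ a ∈ q', a = i ∨ a = b) → wprod n d A q' = wprod n d A q →
      q.length ≤ q'.length) → q = altw i b q.length ∨ q = altw b i q.length := by
    intro q
    induction q with
    | nil => intro _ _; left; rfl
    | cons a t ih =>
      intro hq hred
      have hat := hq a (by simp)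
      have ht : ∀ c ∈ t, c = i ∨ c = b := fun c hc => hq c (by simp [hc])
      have := ih ht (by
        intro q' h1 h2
        have := hred (a :: q') (by simpa [hat] using h1) (by rw [wprod_cons, wprod_cons, h2])
        simpa using this)
      cases t with
      | nil => rcases hat with rfl | rfl <;> simp [altw]
      | cons c t =>
        have hac : a ≠ c := by
          rintro rfl
          have := hred t (fun c hc => ht c (by simp [hc])) (wprod_cc H _ _).symm
          simp at this
        rcases this with h | h
        · have hc : c = i := by simp only [List.length_cons, altw] at h; exact (List.cons.inj h).1
          right
          rw [List.length_cons, altw, ← h]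
          congr 1
          rcases hat with h' | h'
          · exact absurd (h'.trans hc.symm) hac
          · exact h'
        · have hc : c = b := by simp only [List.length_cons, altw] at h; exact (List.cons.inj h).1
          left
          rw [List.length_cons, altw, ← h]
          congr 1
          rcases hat with h' | h'
          · exact h'
          · exact absurd (h'.trans hc.symm) hac
  have hq' : q = altw b i q.length := by
    rcases alt q hq hred with h | h
    · cases q with
      | nil => rfl
      | cons a t =>
        exfalso
        have ha : a = i := by simp only [List.length_cons, altw] at h; exact (List.cons.inj h).1
        have := hi t (fun c hc => hq c (by simp [hc])) (by rw [ha, wprod_cc H])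
        simp at this
    · exact h
  have hltr : ∀ k, ∀ a ∈ altw b i k, a = i ∨ a = b := by
    have : ∀ k (u v : Fin n), ∀ a ∈ altw u v k, a = u ∨ a = v := by
      intro k
      induction k with
      | zero => intro u v a ha; simp [altw] at ha
      | succ k ih =>
        intro u v a ha
        simp only [altw, List.mem_cons] at ha
        rcases ha with h | h
        · exact Or.inl h
        · exact (ih v u a h).symm
    intro k a ha
    exact (this k b i a ha).symm
  rw [hq']
  by_cases hlt : A i b * A b i < 4
  · obtain ⟨m, hm, hw, hpos⟩ := fin_case H hib hlt
    by_cases hk : q.length < m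
    · exact hpos _ hk
    · exfalso
      obtain ⟨t, ht1, ht2⟩ := altw_add b i m (q.length - m)
      rw [Nat.add_sub_cancel' (not_lt.1 hk), ← hq'] at ht2
      have := hi (altw b i (m - 1) ++ t) (by
        intro a ha
        rcases List.mem_append.1 ha with h | h
        · exact hltr _ a h
        · exact hq a (by rw [ht2]; simp [h])) (by
        rw [ht2, ← List.cons_append, wprod_append, wprod_append, hw])
      rw [List.length_append, altw_length, ht1] at this
      omega
  · have := big_pos H q.length i b 1 0 (H.hoff _ _ hib) (H.hoff _ _ hib.symm) (not_lt.1 hlt)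
      (by norm_num) le_rfl (by
        have : (A b i : ℝ) ≤ 0 := by exact_mod_cast H.hoff _ _ hib.symm
        linarith)
    simpa using this

theorem pos_of_len (H : CartanH n d A) (N : ℕ) : ∀ (l : List (Fin n)) (i : Fin n), l.length = N →
    (∀ l', wprod n d A l' = wprod n d A l → l.length ≤ l'.length) →
    (∀ l', wprod n d A l' = wprod n d A (i :: l) → l.length ≤ l'.length) →
    ∀ k, 0 ≤ wprod n d A l (sroot n i) k := by
  induction N using Nat.strong_induction_on with
  | _ N ih =>
  intro l i hN hred hi
  cases l with
  | nil =>
    intro k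
    by_cases hk : k = i
    · subst hk; simp [wprod_nil, sroot]
    · simp [wprod_nil, sroot, hk]
  | cons b l' =>
  have hib : i ≠ b := by
    rintro rfl
    have := hi l' (wprod_cc H _ _).symm
    simp at this
  classical
  set l := b :: l' with hl
  let P : ℕ → Prop := fun m => ∃ p q : List (Fin n), p.length = m ∧ (∀ a ∈ q, a = i ∨ a = b) ∧
    wprod n d A (q ++ p) = wprod n d A l ∧ q.length + p.length = l.length
  have hP : ∃ m, P m := ⟨l'.length, l', [b], rfl, by simp, rfl, by simp [hl]; omega⟩
  have hPle : Nat.find hP ≤ l'.length := Nat.find_min' hP ⟨l', [b], rfl, by simp, rfl, by simp [hl]; omega⟩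
  obtain ⟨p, q, hpm, hq, hw, hlen⟩ := Nat.find_spec hP
  have hmin : ∀ m < p.length, ¬ P m := fun m hm => Nat.find_min hP (hpm ▸ hm)
  have hpN : p.length < N := by
    rw [← hN, hpm, hl, List.length_cons]; omega
  have hpred : ∀ p', wprod n d A p' = wprod n d A p → p.length ≤ p'.length := by
    intro p' h
    have := hred (q ++ p') (by rw [← hw, wprod_append, wprod_append, h])
    rw [List.length_append] at this
    omega
  have hstep : ∀ a, a = i ∨ a = b → ∀ p', wprod n d A p' = wprod n d A (a :: p) →
      p.length ≤ p'.length := by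
    intro a ha p' h
    by_contra hlt
    have e : wprod n d A ((q ++ [a]) ++ p') = wprod n d A l := by
      rw [wprod_append, wprod_append, h, ← hw, wprod_append, wprod_cons]
      have : wprod n d A [a] = simpleRefl n d A a := by simp [wprod_cons, wprod_nil]
      rw [this, mul_assoc, ← mul_assoc _ _ (wprod n d A q), s_mul H, one_mul]
    have h2 := hred _ e
    simp only [List.length_append, List.length_cons, List.length_nil] at h2
    refine hmin p'.length (by omega) ⟨p', q ++ [a], rfl, ?_, e, ?_⟩
    · intro c hc
      rcases List.mem_append.1 hc with h | h
      · exact hq c h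
      · rw [List.mem_singleton.1 h]; exact ha
    · simp only [List.length_append, List.length_cons, List.length_nil]
      omega
  have hpi := ih _ hpN p i rfl hpred (hstep i (Or.inl rfl))
  have hpb := ih _ hpN p b rfl hpred (hstep b (Or.inr rfl))
  obtain ⟨x, y, hx, hy, he⟩ := rank2_lemma H hib q hq (by
    intro q' _ h
    have := hred (q' ++ p) (by rw [← hw, wprod_append, wprod_append, h])
    rw [List.length_append] at this
    omega) (by
    intro q' _ h
    have := hi (q' ++ p) (by
      rw [wprod_cons, ← hw, wprod_append, wprod_append, h, wprod_cons, mul_assoc])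
    rw [List.length_append] at this
    omega)
  intro k
  rw [← hw, wprod_append, Module.End.mul_apply, he, map_add, map_smul, map_smul]
  have := mul_nonneg hx (hpi k)
  have := mul_nonneg hy (hpb k)
  simp only [Pi.add_apply, Pi.smul_apply, smul_eq_mul]
  linarith

theorem exists_red (l : List (Fin n)) : ∃ l₀, wprod n d A l₀ = wprod n d A l ∧
    ∀ l', wprod n d A l' = wprod n d A l → l₀.length ≤ l'.length := by
  classical
  have hP : ∃ m, ∃ l', wprod n d A l' = wprod n d A l ∧ l'.length = m := ⟨_, l, rfl, rfl⟩
  obtain ⟨l₀, h1, h2⟩ := Nat.find_spec hP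
  exact ⟨l₀, h1, fun l' h => h2 ▸ Nat.find_min' hP ⟨l', h, rfl⟩⟩

theorem root_dich (H : CartanH n d A) {β : Fin n → ℝ} (h : IsRoot n d A β) :
    (∀ k, 0 ≤ β k) ∨ (∀ k, β k ≤ 0) := by
  obtain ⟨l, i, rfl⟩ := h
  obtain ⟨l₀, h1, h2⟩ := exists_red (d := d) (A := A) l
  obtain ⟨l₁, h3, h4⟩ := exists_red (d := d) (A := A) (i :: l)
  rcases le_total l₀.length l₁.length with h | h
  · left
    rw [← h1]
    refine pos_of_len H _ l₀ i rfl (by rwa [h1]) fun l' hl' => h.trans (h4 l' ?_)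
    rw [hl', wprod_cons, wprod_cons, h1]
  · right
    have := pos_of_len H _ l₁ i rfl (by rwa [h3]) fun l' hl' => h.trans (h2 l' ?_)
    · rw [h3, wprod_cons, Module.End.mul_apply, s_sroot H, map_neg] at this
      intro k
      have := this k
      simpa using this
    · rw [hl', wprod_cons, h3, wprod_cons, mul_assoc, s_mul H, mul_one]

theorem pos_not_nonpos (H : CartanH n d A) {β : Fin n → ℝ} (h : IsPosRoot n d A β)
    (h' : ∀ k, β k ≤ 0) : False :=
  root_ne H h.1 (funext fun k => le_antisymm (h' k) (h.2 k))

theorem sroot_pos (i : Fin n) : IsPosRoot n d A (sroot n i) := by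
  refine ⟨root_sroot i, fun k => ?_⟩
  by_cases hk : k = i
  · subst hk; simp [sroot]
  · simp [sroot, hk]

theorem pos_prop (H : CartanH n d A) {β γ : Fin n → ℝ} (h : IsPosRoot n d A β)
    (h' : IsPosRoot n d A γ) {c : ℝ} (e : γ = c • β) : γ = β := by
  rcases root_smul H h.1 (c := c) (e ▸ h'.1) with rfl | rfl
  · simpa using e
  · exfalso
    refine pos_not_nonpos H h' fun k => ?_
    have := h.2 k
    rw [e]; simpa using this

theorem pos_coord (H : CartanH n d A) {i : Fin n} {γ : Fin n → ℝ} (h : IsPosRoot n d A γ)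
    (hne : γ ≠ sroot n i) : ∃ k, k ≠ i ∧ 0 < γ k := by
  by_contra hcon
  push Not at hcon
  refine hne (pos_prop H (sroot_pos i) h (c := γ i) ?_)
  ext k
  by_cases hk : k = i
  · subst hk; simp [sroot]
  · have := le_antisymm (hcon k hk) (h.2 k)
    simp [sroot, hk, this]

theorem s_pos (H : CartanH n d A) {i : Fin n} {γ : Fin n → ℝ} (h : IsPosRoot n d A γ)
    (hne : γ ≠ sroot n i) : IsPosRoot n d A (simpleRefl n d A i γ) := by
  obtain ⟨k, hk, hp⟩ := pos_coord H h hne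
  refine ⟨root_s h.1 i, ?_⟩
  rcases root_dich H (root_s h.1 i) with h' | h'
  · exact h'
  · have := h' k
    rw [s_coord H hk] at this
    linarith

theorem neg_pos_root (H : CartanH n d A) {γ : Fin n → ℝ} (h : IsNegRoot n d A γ) :
    IsPosRoot n d A (-γ) :=
  ⟨root_neg H h.1, fun k => by simpa using h.2 k⟩

theorem pos_neg_root (H : CartanH n d A) {γ : Fin n → ℝ} (h : IsPosRoot n d A (-γ)) :
    IsNegRoot n d A γ :=
  ⟨by simpa using root_neg H h.1, fun k => by simpa using h.2 k⟩

theorem refl_sroot_pos (H : CartanH n d A) {i : Fin n} {β : Fin n → ℝ} (h : IsPosRoot n d A β)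
    (hc : cp A i β < 0) : IsPosRoot n d A (reflAlong n d A β (sroot n i)) ∧
      reflAlong n d A β (sroot n i) ≠ sroot n i := by
  have hB := root_form_pos H h.1
  have hdi : (0 : ℝ) < d i := by exact_mod_cast H.hd i
  have hneg : 2 / formL n d A β β * formL n d A β (sroot n i) < 0 := by
    rw [form_symm H β (sroot n i), form_sroot]
    exact mul_neg_of_pos_of_neg (by positivity) (mul_neg_of_pos_of_neg hdi hc)
  refine ⟨⟨root_refl H h.1 (root_sroot i), fun k => ?_⟩, fun e => ?_⟩
  · rw [refl_apply]
    have h1 := (sroot_pos (d := d) (A := A) i).2 k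
    have h2 := h.2 k
    simp only [Pi.sub_apply, Pi.smul_apply, smul_eq_mul]
    nlinarith
  · rw [refl_apply, sub_eq_self, smul_eq_zero] at e
    rcases e with e | e
    · linarith
    · exact root_ne H h.1 e

theorem inv_step1 (H : CartanH n d A) {i : Fin n} {β : Fin n → ℝ} (h : IsPosRoot n d A β)
    (hc : cp A i β < 0) : sroot n i ∈ invSet n d A (simpleRefl n d A i β) := by
  refine ⟨sroot_pos i, pos_neg_root H ?_⟩
  obtain ⟨h1, h2⟩ := refl_sroot_pos H h hc
  have := s_pos H h1 h2
  rwa [← refl_s H, s_sroot H, map_neg] at this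

theorem inv_step2 (H : CartanH n d A) {i : Fin n} {β γ : Fin n → ℝ} (h : IsPosRoot n d A β)
    (hc : cp A i β < 0) (hγ : γ ∈ invSet n d A β) :
    simpleRefl n d A i γ ∈ invSet n d A (simpleRefl n d A i β) := by
  obtain ⟨h1, h2⟩ := refl_sroot_pos H h hc
  refine ⟨s_pos H hγ.1 ?_, pos_neg_root H ?_⟩
  · rintro rfl
    exact pos_not_nonpos H h1 hγ.2.2
  · rw [refl_s H, ← map_neg]
    refine s_pos H (neg_pos_root H hγ.2) fun e => ?_
    have e2 : γ = - reflAlong n d A β (sroot n i) := by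
      rw [← e, map_neg, refl_refl H h.1, neg_neg]
    refine pos_not_nonpos H hγ.1 fun k => ?_
    rw [e2]
    simpa using h1.2 k

/-- `δ` is one of the `δ_k` -/
def IsDelta (n : ℕ) (d : Fin n → ℤ) (A : Fin n → Fin n → ℤ) (l : List (Fin n))
    (δ : Fin n → ℝ) : Prop :=
  ∃ k : Fin l.length, δ = wprod n d A (l.drop (k.1 + 1)) (sroot n (l.get k))

theorem isDelta_concat {l : List (Fin n)} {i : Fin n} {δ : Fin n → ℝ} :
    IsDelta n d A (l ++ [i]) δ ↔ δ = sroot n i ∨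
      ∃ δ', IsDelta n d A l δ' ∧ δ = simpleRefl n d A i δ' := by
  have key : ∀ k (hk : k < l.length), wprod n d A ((l ++ [i]).drop (k + 1))
      (sroot n ((l ++ [i]).get ⟨k, by simp; omega⟩)) =
      simpleRefl n d A i (wprod n d A (l.drop (k + 1)) (sroot n (l.get ⟨k, hk⟩))) := by
    intro k hk
    rw [List.drop_append_of_le_length (by omega), wprod_concat]
    simp [List.getElem_append_left hk]
  constructor
  · rintro ⟨⟨k, hk⟩, rfl⟩
    by_cases hkl : k < l.length
    · exact Or.inr ⟨_, ⟨⟨k, hkl⟩, rfl⟩, key k hkl⟩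
    · left
      simp at hk
      have : k = l.length := by omega
      subst this
      simp [wprod_nil]
  · rintro (rfl | ⟨δ', ⟨⟨k, hk⟩, rfl⟩, rfl⟩)
    · exact ⟨⟨l.length, by simp⟩, by simp [wprod_nil]⟩
    · exact ⟨⟨k, by simp; omega⟩, (key k hk).symm⟩

theorem posExpr_concat (H : CartanH n d A) {j i : Fin n} {l : List (Fin n)}
    (h : IsPosExpr n d A j (l ++ [i])) :
    IsPosExpr n d A j l ∧ cp A i (wprod n d A l (sroot n j)) < 0 := by
  constructor
  · rintro ⟨k, hk⟩
    have := h ⟨k, by simp; omega⟩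
    simp only [List.get_eq_getElem, List.getElem_append_left hk] at this
    rwa [List.take_append_of_le_length (by omega), List.take_append_of_le_length (by omega)] at this
  · obtain ⟨c, hc, h⟩ := h ⟨l.length, by simp⟩
    rw [List.take_of_length_le (by simp), wprod_concat, s_apply H] at h
    have := congrFun h i
    simp [sroot] at this
    simp only [sroot]
    linarith

theorem lemA (H : CartanH n d A) {j : Fin n} {l : List (Fin n)} (h : IsPosExpr n d A j l) :
    IsPosRoot n d A (wprod n d A l (sroot n j)) ∧ ∀ δ, IsDelta n d A l δ →
      δ ∈ invSet n d A (wprod n d A l (sroot n j)) ∧ δ ≠ wprod n d A l (sroot n j) := by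
  induction l using List.reverseRecOn with
  | nil =>
    refine ⟨by simpa [wprod_nil] using sroot_pos j, ?_⟩
    rintro δ ⟨⟨k, hk⟩, _⟩
    simp at hk
  | append_singleton l i ih =>
    obtain ⟨h1, hc⟩ := posExpr_concat H h
    obtain ⟨hp, hδ⟩ := ih h1
    rw [wprod_concat]
    set β := wprod n d A l (sroot n j)
    have hne : β ≠ sroot n i := by
      intro e
      rw [e, cp_sroot, H.hdiag] at hc
      norm_num at hc
    have hp' := s_pos H hp hne
    refine ⟨hp', fun δ hd => ?_⟩
    rcases isDelta_concat.1 hd with rfl | ⟨δ', hd', rfl⟩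
    · refine ⟨inv_step1 H hp hc, fun e => ?_⟩
      have : β = - sroot n i := by rw [← s_sroot H, e, s_s H]
      refine pos_not_nonpos H hp fun k => ?_
      rw [this]
      simpa using (sroot_pos (d := d) (A := A) i).2 k
    · obtain ⟨h2, h3⟩ := hδ δ' hd'
      refine ⟨inv_step2 H hp hc h2, fun e => h3 ?_⟩
      rw [← s_s H i δ', e, s_s H]

theorem core_fund (H : CartanH n d A) {j : Fin n} {β₀ : Fin n → ℝ} (h : IsPosRoot n d A β₀)
    (hne : β₀ ≠ sroot n j) (hc : cp A j β₀ ≤ 0) :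
    ∃ β', IsPosRoot n d A β' ∧ β' ≠ sroot n j ∧ (∃ a b : ℝ, β' = a • sroot n j + b • β₀) ∧
      ∀ γ, IsPosRoot n d A γ → ∀ a b : ℝ, γ = a • sroot n j + b • β₀ →
        ∃ c c' : ℝ, 0 ≤ c ∧ 0 ≤ c' ∧ γ = c • sroot n j + c' • β' := by
  obtain ⟨k, hkj, hk⟩ := pos_coord H h hne
  let T : Set (Fin n → ℝ) := {γ | IsPosRoot n d A γ ∧ ∃ a b : ℝ, 0 ≤ a ∧ 0 < b ∧
    γ = (-a) • sroot n j + b • β₀}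
  have hB := root_form_pos H h.1
  set B := formL n d A β₀ β₀ with hBdef
  let D : ℝ := ∑ i, 2 * (d i : ℝ)
  let C : ℝ := 1 + D / B
  have hfin : T.Finite := by
    refine Set.Finite.subset ((Set.finite_Icc (0 : Fin n → ℤ) (fun m => ⌈C * β₀ m⌉)).image
      (fun z m => (z m : ℝ))) ?_
    rintro γ ⟨hγ, a, b, ha, hb, e⟩
    obtain ⟨z, hz⟩ := root_int H hγ.1
    have hdj : (0 : ℝ) < d j := by exact_mod_cast H.hd j
    have hn : formL n d A γ γ = b ^ 2 * B - 2 * a * b * (d j * cp A j β₀) + a ^ 2 * (2 * d j) := by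
      rw [e]
      simp only [map_add, map_smul, LinearMap.add_apply, LinearMap.smul_apply, form_sroot,
        smul_eq_mul, form_symm H β₀ (sroot n j), cp_sroot, H.hdiag, ← hBdef]
      push_cast; ring
    have hD : formL n d A γ γ ≤ D := by
      obtain ⟨i, hi⟩ := root_form H hγ.1
      rw [hi]
      exact Finset.single_le_sum (f := fun i => 2 * (d i : ℝ)) (fun i _ => by
        have : (0 : ℝ) < d i := by exact_mod_cast H.hd i
        positivity) (Finset.mem_univ i)
    have hb2 : b ^ 2 * B ≤ D := by
      have h1 : 0 ≤ a * b * (d j * -cp A j β₀) :=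
        mul_nonneg (mul_nonneg ha hb.le) (mul_nonneg hdj.le (by linarith))
      have h2 : 0 ≤ a ^ 2 * (2 * (d j : ℝ)) := by positivity
      nlinarith
    have hbC : b ≤ C := by
      have : b ^ 2 ≤ D / B := by rwa [le_div_iff₀ hB]
      simp only [C]
      nlinarith [sq_nonneg (b - 1)]
    refine ⟨z, ⟨fun m => ?_, fun m => ?_⟩, hz.symm⟩
    · have := hγ.2 m
      rw [hz] at this
      simpa using this
    · have h1 : γ m ≤ C * β₀ m := by
        have h2 := (sroot_pos (d := d) (A := A) j).2 m
        have h3 := h.2 m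
        rw [e]
        simp only [Pi.add_apply, Pi.smul_apply, smul_eq_mul]
        nlinarith [mul_le_mul_of_nonneg_right hbC h3, mul_nonneg ha h2]
      have h4 : (z m : ℝ) ≤ ⌈C * β₀ m⌉ := by
        have := h1.trans (Int.le_ceil _)
        rwa [hz] at this
      exact_mod_cast h4
  have hβT : β₀ ∈ T := ⟨h, 0, 1, le_rfl, one_pos, by simp⟩
  obtain ⟨β', ⟨hβ', a', b', ha', hb', e'⟩, hmin⟩ :=
    Set.exists_min_image T (fun γ => γ j / γ k) hfin ⟨_, hβT⟩
  have coj : ∀ a b : ℝ, (a • sroot n j + b • β₀) j = a + b * β₀ j := by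
    intro a b; simp [sroot]
  have cok : ∀ a b : ℝ, (a • sroot n j + b • β₀) k = b * β₀ k := by
    intro a b; simp [sroot, hkj]
  refine ⟨β', hβ', ?_, ⟨-a', b', e'⟩, ?_⟩
  · intro e
    have h1 := cok (-a') b'
    rw [← e', e] at h1
    have : sroot n j k = 0 := by simp [sroot, hkj]
    rw [this] at h1
    have := mul_pos hb' hk
    linarith
  · intro γ hγ a b e
    have hb : 0 ≤ b := by
      have h1 := hγ.2 k
      rw [e, cok] at h1
      exact nonneg_of_mul_nonneg_left h1 hk
    refine ⟨a + b * (a' / b'), b / b', ?_, by positivity, ?_⟩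
    · by_cases ha : 0 ≤ a
      · positivity
      rcases hb.eq_or_lt with hb0 | hb0
      · have h1 := hγ.2 j
        rw [e, coj, ← hb0] at h1
        rw [← hb0]; linarith
      · have h1 := hmin γ ⟨hγ, -a, b, by linarith, hb0, by simpa using e⟩
        simp only [e, e', coj, cok] at h1
        rw [div_le_div_iff₀ (by positivity) (by positivity)] at h1
        have h2 : (-a' + b' * β₀ j) * b ≤ (a + b * β₀ j) * b' := by
          refine le_of_mul_le_mul_right ?_ hk
          linarith
        have h3 : 0 ≤ a * b' + b * a' := by linarith
        have : a + b * (a' / b') = (a * b' + b * a') / b' := by field_simp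
        rw [this]; positivity
    · rw [e, e']
      ext m
      simp only [Pi.add_apply, Pi.smul_apply, smul_eq_mul]
      field_simp
      ring

theorem base_fund (H : CartanH n d A) {j : Fin n} {γ₀ : Fin n → ℝ} (h : IsRoot n d A γ₀)
    (hne : ∀ c : ℝ, γ₀ ≠ c • sroot n j) :
    IsFundamentalIn n d A ({x | IsRoot n d A x} ∩
      (Submodule.span ℝ ({sroot n j, γ₀} : Set (Fin n → ℝ)) : Set (Fin n → ℝ))) (sroot n j) := by
  have h1 : ∃ γ₁, IsPosRoot n d A γ₁ ∧ γ₁ ≠ sroot n j ∧ ∃ u v : ℝ, v ≠ 0 ∧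
      γ₁ = u • sroot n j + v • γ₀ := by
    rcases root_dich H h with h' | h'
    · exact ⟨γ₀, ⟨h, h'⟩, fun e => hne 1 (by simpa using e), 0, 1, one_ne_zero, by simp⟩
    · refine ⟨-γ₀, neg_pos_root H ⟨h, h'⟩, fun e => hne (-1) ?_, 0, -1, by norm_num, by simp⟩
      rw [← e]; simp
  obtain ⟨γ₁, hp, hn1, u, v, hv, e⟩ := h1
  have h2 : ∃ β₀, IsPosRoot n d A β₀ ∧ β₀ ≠ sroot n j ∧ cp A j β₀ ≤ 0 ∧ ∃ u v : ℝ, v ≠ 0 ∧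
      β₀ = u • sroot n j + v • γ₀ := by
    by_cases hc : cp A j γ₁ ≤ 0
    · exact ⟨γ₁, hp, hn1, hc, u, v, hv, e⟩
    · refine ⟨simpleRefl n d A j γ₁, s_pos H hp hn1, ?_, ?_, u - cp A j γ₁, v, hv, ?_⟩
      · intro e
        have : γ₁ = - sroot n j := by rw [← s_sroot H, ← s_s H j γ₁, e]
        refine pos_not_nonpos H hp fun k => ?_
        rw [this]
        simpa using (sroot_pos (d := d) (A := A) j).2 k
      · rw [s_apply H, cp_sub, cp_smul, cp_sroot, H.hdiag]; push_cast; linarith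
      · rw [s_apply H]
        have e' := e
        generalize cp A j γ₁ = t
        rw [e']; ext m; simp; ring
  obtain ⟨β₀, hp0, hn0, hc0, u, v, hv, e⟩ := h2
  obtain ⟨β', hβ', hn', ⟨a', b', e'⟩, hall⟩ := core_fund H hp0 hn0 hc0
  refine ⟨⟨root_sroot j, Submodule.subset_span (by simp)⟩, sroot_pos j, β', ⟨hβ'.1, ?_⟩, hβ', hn', ?_⟩
  · refine Submodule.mem_span_pair.2 ⟨a' + b' * u, b' * v, ?_⟩
    rw [e', e]; ext m; simp; ring
  · rintro γ ⟨hγ, hγs⟩ hγp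
    obtain ⟨a, b, e2⟩ := Submodule.mem_span_pair.1 hγs
    refine hall γ hγp (a - b * u / v) (b / v) ?_
    rw [← e2, e]
    ext m; simp; field_simp; ring

theorem lemB (H : CartanH n d A) {j : Fin n} {l : List (Fin n)} (h : IsPosExpr n d A j l) :
    ∀ γ₀, IsRoot n d A γ₀ → (∀ c : ℝ, γ₀ ≠ c • wprod n d A l (sroot n j)) →
    (∀ δ, IsDelta n d A l δ → δ ∉ Submodule.span ℝ
      ({wprod n d A l (sroot n j), γ₀} : Set (Fin n → ℝ))) →
    IsFundamentalIn n d A ({x | IsRoot n d A x} ∩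
      (Submodule.span ℝ ({wprod n d A l (sroot n j), γ₀} : Set (Fin n → ℝ)) : Set (Fin n → ℝ)))
      (wprod n d A l (sroot n j)) := by
  induction l using List.reverseRecOn with
  | nil =>
    intro γ₀ hr hne _
    simp only [wprod_nil, Module.End.one_apply] at hne ⊢
    exact base_fund H hr hne
  | append_singleton l i ih =>
    obtain ⟨h1, hc⟩ := posExpr_concat H h
    intro γ₀ hr hne hδ
    have hp := (lemA H h).1
    rw [wprod_concat] at hne hδ hp ⊢
    have ih := ih h1 (simpleRefl n d A i γ₀) (root_s hr i)
    set β := wprod n d A l (sroot n j)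
    have tr : ∀ x, x ∈ Submodule.span ℝ ({β, simpleRefl n d A i γ₀} : Set (Fin n → ℝ)) →
        simpleRefl n d A i x ∈
          Submodule.span ℝ ({simpleRefl n d A i β, γ₀} : Set (Fin n → ℝ)) := by
      intro x hx
      obtain ⟨a, b, rfl⟩ := Submodule.mem_span_pair.1 hx
      exact Submodule.mem_span_pair.2 ⟨a, b, by simp [s_s H]⟩
    have tr' : ∀ x, x ∈ Submodule.span ℝ ({simpleRefl n d A i β, γ₀} : Set (Fin n → ℝ)) →
        simpleRefl n d A i x ∈
          Submodule.span ℝ ({β, simpleRefl n d A i γ₀} : Set (Fin n → ℝ)) := by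
      intro x hx
      obtain ⟨a, b, rfl⟩ := Submodule.mem_span_pair.1 hx
      exact Submodule.mem_span_pair.2 ⟨a, b, by simp [s_s H]⟩
    have hαi : sroot n i ∉ Submodule.span ℝ ({simpleRefl n d A i β, γ₀} : Set (Fin n → ℝ)) :=
      hδ _ (isDelta_concat.2 (Or.inl rfl))
    obtain ⟨h2, h3, η, hη, hηp, hηn, hall⟩ := ih (by
      intro c e
      refine hne c ?_
      rw [← s_s H i γ₀, e, map_smul]) (by
      intro δ hd hm
      exact hδ _ (isDelta_concat.2 (Or.inr ⟨δ, hd, rfl⟩)) (tr _ hm))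
    have hηi : η ≠ sroot n i := by
      rintro rfl
      have := tr _ hη.2
      rw [s_sroot H, Submodule.neg_mem_iff] at this
      exact hαi this
    refine ⟨⟨hp.1, Submodule.subset_span (by simp)⟩, hp, simpleRefl n d A i η,
      ⟨root_s hη.1 i, tr _ hη.2⟩, s_pos H hηp hηi, ?_, ?_⟩
    · intro e
      exact hηn (by rw [← s_s H i η, e, s_s H])
    · rintro γ ⟨hγ, hγs⟩ hγp
      have hγi : γ ≠ sroot n i := by
        rintro rfl
        exact hαi hγs
      obtain ⟨c, c', hc, hc', e⟩ := hall (simpleRefl n d A i γ) ⟨root_s hγ i, tr' _ hγs⟩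
        (s_pos H hγp hγi)
      exact ⟨c, c', hc, hc', by rw [← s_s H i γ, e, map_add, map_smul, map_smul]⟩

theorem span_exch {β γ δ : Fin n → ℝ} (h : δ ∈ Submodule.span ℝ ({β, γ} : Set (Fin n → ℝ)))
    (hne : ∀ c : ℝ, δ ≠ c • β) : Submodule.span ℝ ({β, γ} : Set (Fin n → ℝ)) =
      Submodule.span ℝ ({β, δ} : Set (Fin n → ℝ)) := by
  obtain ⟨a, b, e⟩ := Submodule.mem_span_pair.1 h
  have hb : b ≠ 0 := by
    rintro rfl
    exact hne a (by rw [← e]; simp)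
  apply le_antisymm
  · rw [Submodule.span_le]
    rintro x (rfl | rfl)
    · exact Submodule.subset_span (by simp)
    · refine Submodule.mem_span_pair.2 ⟨-(a / b), 1 / b, ?_⟩
      rw [← e]; ext m; simp; field_simp; ring
  · rw [Submodule.span_le]
    rintro x (rfl | rfl)
    · exact Submodule.subset_span (by simp)
    · exact h

theorem pos_ne_smul (H : CartanH n d A) {β γ : Fin n → ℝ} (h : IsPosRoot n d A β)
    (h' : IsPosRoot n d A γ) (hne : γ ≠ β) (c : ℝ) : γ ≠ c • β :=
  fun e => hne (pos_prop H h h' e)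

theorem rank2_ex (H : CartanH n d A) {R : Set (Fin n → ℝ)} {β : Fin n → ℝ}
    (hR : IsRankTwo n d A R) (hβ : β ∈ R) (hr : IsRoot n d A β) :
    ∃ γ₀, IsRoot n d A γ₀ ∧ (∀ c : ℝ, γ₀ ≠ c • β) ∧ R = {x | IsRoot n d A x} ∩
      (Submodule.span ℝ ({β, γ₀} : Set (Fin n → ℝ)) : Set (Fin n → ℝ)) := by
  obtain ⟨L, hL, rfl, hspan⟩ := hR
  have : ∃ γ₀ ∈ {γ | IsRoot n d A γ} ∩ (L : Set (Fin n → ℝ)), ∀ c : ℝ, γ₀ ≠ c • β := by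
    by_contra hcon
    push Not at hcon
    have hle : L ≤ Submodule.span ℝ {β} := by
      rw [← hspan, Submodule.span_le]
      intro x hx
      obtain ⟨c, rfl⟩ := hcon x hx
      exact Submodule.smul_mem _ _ (Submodule.mem_span_singleton_self β)
    have := Submodule.finrank_mono hle
    rw [hL, finrank_span_singleton (root_ne H hr)] at this
    omega
  obtain ⟨γ₀, hγ, hne⟩ := this
  refine ⟨γ₀, hγ.1, hne, ?_⟩
  have hli : LinearIndependent ℝ ![β, γ₀] := by
    rw [LinearIndependent.pair_iff' (root_ne H hr)]
    exact fun a => (hne a).symm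
  have hrk := finrank_span_eq_card hli
  rw [Matrix.range_cons, Matrix.range_cons, Matrix.range_empty, Set.union_empty,
    ← Set.insert_eq] at hrk
  have hle : Submodule.span ℝ ({β, γ₀} : Set (Fin n → ℝ)) ≤ L := by
    rw [Submodule.span_le]
    rintro x (rfl | rfl)
    · exact hβ.2
    · exact hγ.2
  have := Submodule.eq_of_le_of_finrank_eq hle (by
    rw [hL, hrk]; simp)
  rw [this]

theorem rank2_mk (H : CartanH n d A) {β γ : Fin n → ℝ} (hr : IsRoot n d A β)
    (hγ : IsRoot n d A γ) (hne : ∀ c : ℝ, γ ≠ c • β) :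
    IsRankTwo n d A ({x | IsRoot n d A x} ∩
      (Submodule.span ℝ ({β, γ} : Set (Fin n → ℝ)) : Set (Fin n → ℝ))) := by
  refine ⟨Submodule.span ℝ {β, γ}, ?_, rfl, ?_⟩
  · have hli : LinearIndependent ℝ ![β, γ] := by
      rw [LinearIndependent.pair_iff' (root_ne H hr)]
      exact fun a => (hne a).symm
    have hrk := finrank_span_eq_card hli
    rw [Matrix.range_cons, Matrix.range_cons, Matrix.range_empty, Set.union_empty,
    ← Set.insert_eq] at hrk
    rw [hrk]; simp
  · apply le_antisymm
    · rw [Submodule.span_le]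
      exact Set.inter_subset_right
    · apply Submodule.span_mono
      rintro x (rfl | rfl)
      · exact ⟨hr, Submodule.subset_span (by simp)⟩
      · exact ⟨hγ, Submodule.subset_span (by simp)⟩

theorem cut_of_inv (H : CartanH n d A) {β γ : Fin n → ℝ} (hβ : IsPosRoot n d A β)
    (hγ : γ ∈ invSet n d A β) (hne : γ ≠ β) :
    CutsPerp n d A ({x | IsRoot n d A x} ∩
      (Submodule.span ℝ ({β, γ} : Set (Fin n → ℝ)) : Set (Fin n → ℝ))) β := by
  have hns := pos_ne_smul H hβ hγ.1 hne
  refine ⟨rank2_mk H hβ.1 hγ.1.1 hns, ⟨hβ.1, Submodule.subset_span (by simp)⟩, ?_⟩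
  rintro ⟨_, _, β', _, hp', hn', hall⟩
  obtain ⟨a, a', ha, ha', e⟩ := hall γ ⟨hγ.1.1, Submodule.subset_span (by simp)⟩ hγ.1
  have hq := neg_pos_root H hγ.2
  obtain ⟨b, b', hb, hb', e2⟩ := hall _ ⟨hq.1, by
    rw [refl_apply]
    exact Submodule.neg_mem _ (Submodule.sub_mem _ (Submodule.subset_span (by simp))
      (Submodule.smul_mem _ _ (Submodule.subset_span (by simp))))⟩ hq
  rw [refl_apply] at e2
  set c := 2 / formL n d A β β * formL n d A β γ
  have h0 : a' = 0 := by
    by_contra h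
    have hpos : 0 < a' + b' := by positivity
    refine pos_ne_smul H hβ hp' hn' ((c - a - b) / (a' + b')) ?_
    ext m
    have h1 := congrFun e m
    have h2 := congrFun e2 m
    simp only [Pi.add_apply, Pi.smul_apply, smul_eq_mul, Pi.neg_apply, Pi.sub_apply] at h1 h2 ⊢
    field_simp
    linarith
  exact hns a (by rw [e, h0]; simp)

end aux

/-- for a positive root `β` with positive expression
`β = s i_r ⋯ s i_1 (α j)` and `δ_k = s i_r ⋯ s i_{k+1} (α i_k)`, the following
three collections of rank two subsystems coincide: those cutting `β^⊥`; those of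
the form `Φ ∩ span(β, γ)` for `γ ∈ inv_Φ(t_β)`, `γ ≠ β`; and those of the form
`Φ ∩ span(β, δ_k)`. -/
theorem stmt6 (n : ℕ) (hn : 1 ≤ n) (d : Fin n → ℤ) (A : Fin n → Fin n → ℤ)
    (hd : ∀ i, 0 < d i) (hdiag : ∀ i, A i i = 2)
    (hoff : ∀ i j, i ≠ j → A i j ≤ 0)
    (hsym : ∀ i j, d i * A i j = d j * A j i)
    (j : Fin n) (l : List (Fin n)) (hl : IsPosExpr n d A j l)
    (β : Fin n → ℝ) (hβ : β = wprod n d A l (sroot n j)) :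
    ({R | CutsPerp n d A R β}
        = {R | ∃ γ ∈ invSet n d A β, γ ≠ β ∧
            R = {x | IsRoot n d A x} ∩
              (Submodule.span ℝ ({β, γ} : Set (Fin n → ℝ)) : Set (Fin n → ℝ))})
    ∧ ({R | CutsPerp n d A R β}
        = {R | ∃ k : Fin l.length,
            R = {x | IsRoot n d A x} ∩
              (Submodule.span ℝ
                ({β, wprod n d A (l.drop (k.1 + 1)) (sroot n (l.get k))} :
                  Set (Fin n → ℝ)) : Set (Fin n → ℝ))}) := by
  have H : CartanH n d A := ⟨hd, hdiag, hoff, hsym⟩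
  obtain ⟨hp, hδ⟩ := lemA H hl
  have hB := lemB H hl
  rw [← hβ] at hp hδ hB
  have h13 : ∀ R, CutsPerp n d A R β → ∃ δ, IsDelta n d A l δ ∧ R = {x | IsRoot n d A x} ∩
              (Submodule.span ℝ ({β, δ} : Set (Fin n → ℝ)) : Set (Fin n → ℝ)) := by
    rintro R ⟨hR, hβR, hnf⟩
    obtain ⟨γ₀, hr, hne, rfl⟩ := rank2_ex H hR hβR hp.1
    have hex : ∃ δ, IsDelta n d A l δ ∧
        δ ∈ Submodule.span ℝ ({β, γ₀} : Set (Fin n → ℝ)) := by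
      by_contra hcon
      push Not at hcon
      exact hnf (hB γ₀ hr hne hcon)
    obtain ⟨δ, hd1, hd2⟩ := hex
    refine ⟨δ, hd1, ?_⟩
    obtain ⟨h1, h2⟩ := hδ δ hd1
    rw [span_exch hd2 (pos_ne_smul H hp h1.1 h2)]
  constructor
  · ext R
    constructor
    · intro hR
      obtain ⟨δ, h1, h2⟩ := h13 R hR
      exact ⟨δ, (hδ δ h1).1, (hδ δ h1).2, h2⟩
    · rintro ⟨γ, h1, h2, rfl⟩
      exact cut_of_inv H hp h1 h2
  · ext R
    constructor
    · intro hR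
      obtain ⟨δ, ⟨k, rfl⟩, h2⟩ := h13 R hR
      exact ⟨k, h2⟩
    · rintro ⟨k, rfl⟩
      obtain ⟨h1, h2⟩ := hδ _ ⟨k, rfl⟩
      exact cut_of_inv H hp h1 h2

end
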